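/- Let |ψ⟩ be a stabilizer state on n qubits and let ω be a minimal support of 𝒮(ψ). Then the number A_ω(ψ) of elements of 𝒮(ψ) with support exactly ω is equal to 1 or 3, and the value 3 can only occur if |ω| is even. -/

import Mathlib

open Matrix

noncomputable section

/-- Pauli matrices: `0 ↦ σ₀` (identity), `1 ↦ σₓ`, `2 ↦ σ_y`, `3 ↦ σ_z`. -/
def pauliMat : Fin 4 → Matrix (Fin 2) (Fin 2) ℂ :=
  ![1, !![0, 1; 1, 0], !![0, -Complex.I; Complex.I, 0], !![1, 0; 0, -1]]

/-- Tensor (Kronecker) product of a family of one-qubit operators, as an operator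
on qubits indexed by `ι`. -/
def kron {ι : Type} [Fintype ι] (U : ι → Matrix (Fin 2) (Fin 2) ℂ) :
    Matrix (ι → Fin 2) (ι → Fin 2) ℂ :=
  Matrix.of fun x y => ∏ i, U i (x i) (y i)

/-- An element of the Pauli group: a phase in `{1, -1, i, -i}` together with a
Pauli label (`σ₀, σₓ, σ_y, σ_z`) on every qubit. -/
structure PauliOp (ι : Type) where
  phase : ℂ
  label : ι → Fin 4
  phase_ok : phase = 1 ∨ phase = -1 ∨ phase = Complex.I ∨ phase = -Complex.I

noncomputable instance {ι : Type} : DecidableEq (PauliOp ι) := Classical.decEq _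

/-- The matrix of a Pauli group element. -/
def PauliOp.toMatrix {ι : Type} [Fintype ι] (M : PauliOp ι) :
    Matrix (ι → Fin 2) (ι → Fin 2) ℂ :=
  M.phase • kron fun i => pauliMat (M.label i)

/-- The support of a Pauli operator: the set of qubits on which it acts nontrivially. -/
def PauliOp.support {ι : Type} [Fintype ι] [DecidableEq ι] (M : PauliOp ι) : Finset ι :=
  Finset.univ.filter fun i => M.label i ≠ 0

/-- A (maximal) stabilizer on the qubits indexed by `ι`: an abelian subgroup of the
Pauli group of cardinality `2^|ι|` which does not contain `-I`. -/
structure Stabilizer (ι : Type) [Fintype ι] [DecidableEq ι] where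
  elems : Finset (PauliOp ι)
  one_mem : ∃ M ∈ elems, PauliOp.toMatrix M = 1
  mul_mem : ∀ M ∈ elems, ∀ N ∈ elems, ∃ K ∈ elems,
    PauliOp.toMatrix K = PauliOp.toMatrix M * PauliOp.toMatrix N
  comm : ∀ M ∈ elems, ∀ N ∈ elems,
    PauliOp.toMatrix M * PauliOp.toMatrix N = PauliOp.toMatrix N * PauliOp.toMatrix M
  neg_one_not_mem : ∀ M ∈ elems, PauliOp.toMatrix M ≠ -1
  card_elems : elems.card = 2 ^ Fintype.card ι

variable {ι : Type} [Fintype ι] [DecidableEq ι]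

/-- `ψ` is the stabilizer state of the stabilizer `S`: it is a unit vector fixed by
every element of `S`. -/
def stabilizesState (S : Stabilizer ι) (ψ : (ι → Fin 2) → ℂ) : Prop :=
  (∑ x, Complex.normSq (ψ x)) = 1 ∧ ∀ M ∈ S.elems, (PauliOp.toMatrix M).mulVec ψ = ψ

/-- `ψ` is a stabilizer state. -/
def IsStabilizerState (ψ : (ι → Fin 2) → ℂ) : Prop :=
  ∃ S : Stabilizer ι, stabilizesState S ψ

/-- `A_ω(ψ)`: the number of stabilizer elements with support exactly `ω`. -/
def Aomega (S : Stabilizer ι) (ω : Finset ι) : ℕ :=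
  (S.elems.filter fun M => PauliOp.support M = ω).card

/-- `ω` is a minimal support of `S`: it is the support of some element of `S`, and no
element of `S` has nonempty support strictly contained in `ω`. -/
def IsMinimalSupport (S : Stabilizer ι) (ω : Finset ι) : Prop :=
  (∃ M ∈ S.elems, PauliOp.support M = ω) ∧
    ∀ M ∈ S.elems, PauliOp.support M ⊂ ω → PauliOp.support M = ∅

/-- The matrices of the minimal elements of `S` (the elements whose support is a
minimal support). -/
def minimalMatrices (S : Stabilizer ι) : Set (Matrix (ι → Fin 2) (ι → Fin 2) ℂ) :=
  {A | ∃ M ∈ S.elems, IsMinimalSupport S (PauliOp.support M) ∧ PauliOp.toMatrix M = A}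

/-- `M` belongs to the subgroup `ℳ(ψ)` of `S` generated by the minimal elements.
(Every stabilizer element is an involution, so the generated submonoid coincides with
the generated subgroup.) -/
def inMinimalSubgroup (S : Stabilizer ι) (M : PauliOp ι) : Prop :=
  M ∈ S.elems ∧ PauliOp.toMatrix M ∈ Submonoid.closure (minimalMatrices S)

/-- A one-qubit Clifford operation: a unitary mapping each of the three Pauli matrices
to a Pauli matrix, up to sign, under conjugation. -/
def IsClifford (U : Matrix (Fin 2) (Fin 2) ℂ) : Prop :=
  U ∈ Matrix.unitaryGroup (Fin 2) ℂ ∧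
    ∃ π : Equiv.Perm (Fin 3), ∀ u : Fin 3, ∃ s : ℂ, (s = 1 ∨ s = -1) ∧
      U * pauliMat u.succ * Uᴴ = s • pauliMat (π u).succ

/-- Local unitary equivalence of pure states. -/
def LUequiv (ψ φ : (ι → Fin 2) → ℂ) : Prop :=
  ∃ U : ι → Matrix (Fin 2) (Fin 2) ℂ,
    (∀ i, U i ∈ Matrix.unitaryGroup (Fin 2) ℂ) ∧ (kron U).mulVec ψ = φ

/-- Local Clifford equivalence of pure states. -/
def LCequiv (ψ φ : (ι → Fin 2) → ℂ) : Prop :=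
  ∃ U : ι → Matrix (Fin 2) (Fin 2) ℂ,
    (∀ i, IsClifford (U i)) ∧ (kron U).mulVec ψ = φ

/-- Local Clifford equivalence of (possibly mixed) states. -/
def LCequivMixed (ρ ρ' : Matrix (ι → Fin 2) (ι → Fin 2) ℂ) : Prop :=
  ∃ U : ι → Matrix (Fin 2) (Fin 2) ℂ,
    (∀ i, IsClifford (U i)) ∧ kron U * ρ * (kron U)ᴴ = ρ'

/-- A pure state is fully entangled if it is not a tensor product of states on two
complementary nonempty subsets of the qubits. -/
def FullyEntangled (ψ : (ι → Fin 2) → ℂ) : Prop :=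
  ¬ ∃ (ω : Finset ι) (φ : ({i // i ∈ ω} → Fin 2) → ℂ) (χ : ({i // i ∉ ω} → Fin 2) → ℂ),
      ω ≠ ∅ ∧ ω ≠ Finset.univ ∧
        ∀ x : ι → Fin 2, ψ x = φ (fun i => x i.1) * χ (fun i => x i.1)

/-- Recombine an assignment on `ω` and one on its complement into a global assignment. -/
def mergeAssign (ω : Finset ι) (x : {i // i ∈ ω} → Fin 2) (z : {i // i ∉ ω} → Fin 2) :
    ι → Fin 2 :=
  fun i => if h : i ∈ ω then x ⟨i, h⟩ else z ⟨i, h⟩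

/-- The reduced density matrix `ρ_ω(ψ)` of the pure state `ψ` on the qubits in `ω`
(partial trace of `|ψ⟩⟨ψ|` over the qubits outside `ω`). -/
def reducedState (ψ : (ι → Fin 2) → ℂ) (ω : Finset ι) :
    Matrix ({i // i ∈ ω} → Fin 2) ({i // i ∈ ω} → Fin 2) ℂ :=
  Matrix.of fun x y =>
    ∑ z : {i // i ∉ ω} → Fin 2, ψ (mergeAssign ω x z) * (starRingEnd ℂ) (ψ (mergeAssign ω y z))

/-- The restriction `α_M M_{i₁} ⊗ ⋯ ⊗ M_{i_k}` of a Pauli operator to the qubits in `ω`. -/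
def PauliOp.restrict (M : PauliOp ι) (ω : Finset ι) :
    Matrix ({i // i ∈ ω} → Fin 2) ({i // i ∈ ω} → Fin 2) ℂ :=
  M.phase • kron fun i : {i // i ∈ ω} => pauliMat (M.label i.1)

/-- The `n`-qubit GHZ state `(|0…0⟩ + |1…1⟩)/√2`. -/
def ghz (n : ℕ) : (Fin n → Fin 2) → ℂ :=
  fun x => if x = (fun _ => 0) ∨ x = (fun _ => 1) then ((Real.sqrt 2 : ℝ)⁻¹ : ℂ) else 0

/-- The `2n × 2n` binary symplectic form `P = [[0, I], [I, 0]]`. -/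
def Pmat (n : ℕ) : Matrix (Fin n ⊕ Fin n) (Fin n ⊕ Fin n) (ZMod 2) :=
  Matrix.fromBlocks 0 1 1 0

end

/-- The tensor product of one-qubit operators is multiplicative. -/
lemma kron_mul {ι : Type} [Fintype ι] [DecidableEq ι] (U V : ι → Matrix (Fin 2) (Fin 2) ℂ) :
    kron U * kron V = kron fun i => U i * V i := by
  ext x y
  simp only [kron, Matrix.mul_apply, Matrix.of_apply, ← Finset.prod_mul_distrib]
  rw [Finset.prod_univ_sum, Fintype.piFinset_univ]

lemma kron_smul {ι : Type} [Fintype ι] (c : ι → ℂ) (U : ι → Matrix (Fin 2) (Fin 2) ℂ) :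
    (kron fun i => c i • U i) = (∏ i, c i) • kron U := by
  ext x y
  simp [kron, Finset.prod_mul_distrib]

lemma trace_kron {ι : Type} [Fintype ι] [DecidableEq ι] (U : ι → Matrix (Fin 2) (Fin 2) ℂ) :
    (kron U).trace = ∏ i, (U i).trace := by
  simp only [kron, Matrix.trace, Matrix.diag_apply, Matrix.of_apply]
  rw [Finset.prod_univ_sum, Fintype.piFinset_univ]

lemma trace_pauliMat_mul (a b : Fin 4) :
    (pauliMat a * pauliMat b).trace = if a = b then 2 else 0 := by
  fin_cases a <;> fin_cases b <;>
    simp [pauliMat, Matrix.trace_fin_two, Matrix.one_fin_two, one_add_one_eq_two]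

lemma pauliMat_mul (a b : Fin 4) :
    ∃ c : ℂ, pauliMat a * pauliMat b = c • pauliMat (a ^^^ b) := by
  fin_cases a <;> fin_cases b <;>
    first
      | refine ⟨1, ?_⟩; ext i j; fin_cases i <;> fin_cases j <;>
          simp [pauliMat, Matrix.one_fin_two]; done
      | refine ⟨Complex.I, ?_⟩; ext i j; fin_cases i <;> fin_cases j <;>
          simp [pauliMat, Matrix.one_fin_two]; done
      | refine ⟨-Complex.I, ?_⟩; ext i j; fin_cases i <;> fin_cases j <;>
          simp [pauliMat, Matrix.one_fin_two]

lemma pauliMat_anticomm {a b : Fin 4} (ha : a ≠ 0) (hb : b ≠ 0) (hab : a ≠ b) :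
    pauliMat a * pauliMat b = (-1 : ℂ) • (pauliMat b * pauliMat a) := by
  fin_cases a <;> fin_cases b <;> first | contradiction | simp [pauliMat]

lemma Fin.xor_four_eq_zero_iff : ∀ a b : Fin 4, a ^^^ b = 0 ↔ a = b := by decide

lemma Fin.xor_four_eq_left_iff : ∀ a b : Fin 4, a ^^^ b = a ↔ b = 0 := by decide

lemma Fin.xor_four_eq_right_iff : ∀ a b : Fin 4, a ^^^ b = b ↔ a = 0 := by decide

/-- Proportional Pauli strings have the same labels. -/
lemma eq_of_kron_pauliMat_eq_smul {ι : Type} [Fintype ι] [DecidableEq ι] {a b : ι → Fin 4} {c : ℂ}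
    (h : (kron fun i => pauliMat (a i)) = c • kron fun i => pauliMat (b i)) : a = b := by
  by_contra hab
  obtain ⟨j, hj⟩ := Function.ne_iff.mp hab
  have key := congrArg (fun A => ((kron fun i => pauliMat (a i)) * A).trace) h
  simp only [Matrix.mul_smul, Matrix.trace_smul, kron_mul, trace_kron, trace_pauliMat_mul] at key
  rw [Finset.prod_eq_zero (f := fun i => if a i = b i then (2 : ℂ) else 0) (Finset.mem_univ j)
    (if_neg hj)] at key
  simp at key

namespace PauliOp

lemma phase_ne_zero {ι : Type} (M : PauliOp ι) : M.phase ≠ 0 := by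
  rcases M.phase_ok with h | h | h | h <;> simp [h]

lemma toMatrix_mul {ι : Type} [Fintype ι] [DecidableEq ι] (M N : PauliOp ι) :
    M.toMatrix * N.toMatrix =
      (M.phase * N.phase) • kron fun i => pauliMat (M.label i) * pauliMat (N.label i) := by
  simp only [toMatrix, Matrix.smul_mul, Matrix.mul_smul, smul_smul, kron_mul,
    mul_comm N.phase]

lemma label_eq_xor {ι : Type} [Fintype ι] [DecidableEq ι] {M N K : PauliOp ι}
    (h : K.toMatrix = M.toMatrix * N.toMatrix) (i : ι) :
    K.label i = M.label i ^^^ N.label i := by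
  choose c hc using pauliMat_mul
  simp only [toMatrix_mul, hc, kron_smul, smul_smul] at h
  refine congrFun (eq_of_kron_pauliMat_eq_smul (a := K.label)
    (b := fun i => M.label i ^^^ N.label i)
    (c := K.phase⁻¹ * (M.phase * N.phase * ∏ i, c (M.label i) (N.label i))) ?_) i
  rw [← smul_smul, ← h, toMatrix, inv_smul_smul₀ K.phase_ne_zero]

lemma mem_support {ι : Type} [Fintype ι] [DecidableEq ι] {M : PauliOp ι} {i : ι} :
    i ∈ M.support ↔ M.label i ≠ 0 := by
  simp [support]

lemma eq_of_label_eq {ι : Type} [Fintype ι] [DecidableEq ι] {M N : PauliOp ι} {ψ : (ι → Fin 2) → ℂ} (hψ : ψ ≠ 0)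
    (hM : M.toMatrix.mulVec ψ = ψ) (hN : N.toMatrix.mulVec ψ = ψ) (h : M.label = N.label) :
    M = N := by
  obtain ⟨p, a, hp⟩ := M
  obtain ⟨q, b, hq⟩ := N
  obtain rfl : a = b := h
  simp only [toMatrix, Matrix.smul_mulVec] at hM hN
  have hv : (kron fun i => pauliMat (a i)).mulVec ψ ≠ 0 := fun h0 =>
    hψ (by rw [← hM, h0, smul_zero])
  obtain rfl : p = q := smul_left_injective ℂ hv (hM.trans hN.symm)
  rfl

/-- Exchanging two Pauli operators of support `ω` that differ at every qubit of `ω` gives a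
sign `-1` for each of these qubits. -/
lemma toMatrix_mul_eq_neg_one_pow {ι : Type} [Fintype ι] [DecidableEq ι] {M N : PauliOp ι}
    {ω : Finset ι} (hM : M.support = ω) (hN : N.support = ω)
    (h : ∀ i ∈ ω, M.label i ≠ N.label i) :
    M.toMatrix * N.toMatrix = (-1 : ℂ) ^ ω.card • (N.toMatrix * M.toMatrix) := by
  have key : ∀ i, pauliMat (M.label i) * pauliMat (N.label i) =
      (if i ∈ ω then -1 else 1 : ℂ) • (pauliMat (N.label i) * pauliMat (M.label i)) := by
    intro i
    split_ifs with hi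
    · exact pauliMat_anticomm (mem_support.mp (hM ▸ hi)) (mem_support.mp (hN ▸ hi)) (h i hi)
    · have h0 : M.label i = 0 := by_contra fun hc => hi (hM ▸ mem_support.mpr hc)
      have h1 : N.label i = 0 := by_contra fun hc => hi (hN ▸ mem_support.mpr hc)
      rw [h0, h1, one_smul]
  rw [toMatrix_mul, toMatrix_mul, funext key, kron_smul, Finset.prod_ite_mem, Finset.univ_inter,
    Finset.prod_const, smul_comm, mul_comm N.phase]

end PauliOp

lemma stabilizesState.ne_zero {ι : Type} [Fintype ι] [DecidableEq ι] {S : Stabilizer ι}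
    {ψ : (ι → Fin 2) → ℂ} (hψ : stabilizesState S ψ) : ψ ≠ 0 := by
  rintro rfl
  simpa using hψ.1

/-- Two stabilizer elements on the same minimal support agree as soon as they agree at one qubit
of that support. -/
lemma IsMinimalSupport.eq_of_label_eq {ι : Type} [Fintype ι] [DecidableEq ι] {S : Stabilizer ι}
    {ψ : (ι → Fin 2) → ℂ} (hψ : stabilizesState S ψ) {ω : Finset ι} (hω : IsMinimalSupport S ω)
    {M N : PauliOp ι} (hM : M ∈ S.elems) (hN : N ∈ S.elems) (hMω : M.support = ω)
    (hNω : N.support = ω) {i : ι} (hi : i ∈ ω) (h : M.label i = N.label i) : M = N := by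
  obtain ⟨K, hK, hKMN⟩ := S.mul_mem M hM N hN
  have hlab := PauliOp.label_eq_xor hKMN
  have hsub : K.support ⊂ ω := by
    refine Finset.ssubset_iff_of_subset (fun j hj => ?_) |>.mpr ⟨i, hi, fun hiK => ?_⟩
    · by_contra hjω
      have h0 : M.label j = 0 := by_contra fun hc => hjω (hMω ▸ PauliOp.mem_support.mpr hc)
      have h1 : N.label j = 0 := by_contra fun hc => hjω (hNω ▸ PauliOp.mem_support.mpr hc)
      exact PauliOp.mem_support.mp hj
        ((hlab j).trans ((Fin.xor_four_eq_zero_iff _ _).mpr (h0.trans h1.symm)))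
    · exact PauliOp.mem_support.mp hiK ((hlab i).trans ((Fin.xor_four_eq_zero_iff _ _).mpr h))
  have hempty := hω.2 K hK hsub
  refine PauliOp.eq_of_label_eq hψ.ne_zero (hψ.2 M hM) (hψ.2 N hN) (funext fun j => ?_)
  rw [← Fin.xor_four_eq_zero_iff, ← hlab j]
  by_contra hc
  exact Finset.notMem_empty j (hempty ▸ PauliOp.mem_support.mpr hc)

/-- A minimal support carrying two distinct stabilizer elements also carries a third one. -/
lemma IsMinimalSupport.exists_third {ι : Type} [Fintype ι] [DecidableEq ι] {S : Stabilizer ι}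
    {ψ : (ι → Fin 2) → ℂ} (hψ : stabilizesState S ψ) {ω : Finset ι} (hω : IsMinimalSupport S ω)
    (hne : ω.Nonempty) {M N : PauliOp ι} (hM : M ∈ S.elems) (hN : N ∈ S.elems)
    (hMω : M.support = ω) (hNω : N.support = ω) (hMN : M ≠ N) :
    ∃ K ∈ S.elems, K.support = ω ∧ K ≠ M ∧ K ≠ N := by
  obtain ⟨K, hK, hKMN⟩ := S.mul_mem M hM N hN
  have hlab := PauliOp.label_eq_xor hKMN
  obtain ⟨i, hi⟩ := hne
  have hMi : M.label i ≠ 0 := PauliOp.mem_support.mp (hMω ▸ hi)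
  have hNi : N.label i ≠ 0 := PauliOp.mem_support.mp (hNω ▸ hi)
  refine ⟨K, hK, ?_, ?_, ?_⟩
  · ext j
    rw [PauliOp.mem_support, hlab, Ne, Fin.xor_four_eq_zero_iff]
    refine ⟨fun h => by_contra fun hj => h ?_, fun hj h =>
      hMN (hω.eq_of_label_eq hψ hM hN hMω hNω hj h)⟩
    have h0 : M.label j = 0 := by_contra fun hc => hj (hMω ▸ PauliOp.mem_support.mpr hc)
    have h1 : N.label j = 0 := by_contra fun hc => hj (hNω ▸ PauliOp.mem_support.mpr hc)
    exact h0.trans h1.symm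
  · rintro rfl
    exact hNi ((Fin.xor_four_eq_left_iff _ _).mp (hlab i).symm)
  · rintro rfl
    exact hMi ((Fin.xor_four_eq_right_iff _ _).mp (hlab i).symm)

/-- A minimal support carrying two distinct stabilizer elements has even cardinality. -/
lemma IsMinimalSupport.even_card {ι : Type} [Fintype ι] [DecidableEq ι] {S : Stabilizer ι}
    {ψ : (ι → Fin 2) → ℂ} (hψ : stabilizesState S ψ) {ω : Finset ι} (hω : IsMinimalSupport S ω)
    {M N : PauliOp ι} (hM : M ∈ S.elems) (hN : N ∈ S.elems)
    (hMω : M.support = ω) (hNω : N.support = ω) (hMN : M ≠ N) : Even ω.card := by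
  by_contra hodd
  have hanti := PauliOp.toMatrix_mul_eq_neg_one_pow hMω hNω fun i hi h =>
    hMN (hω.eq_of_label_eq hψ hM hN hMω hNω hi h)
  rw [(Nat.not_even_iff_odd.mp hodd).neg_one_pow, ← S.comm M hM N hN] at hanti
  have h := congrArg (fun A => A.mulVec ψ) hanti
  simp only [neg_smul, one_smul, Matrix.neg_mulVec, ← Matrix.mulVec_mulVec, hψ.2 M hM,
    hψ.2 N hN] at h
  exact hψ.ne_zero (self_eq_neg.mp h)

/-- For a minimal support `ω` of the stabilizer of a stabilizer state,
`A_ω(ψ)` equals `1` or `3`, and the value `3` can only occur if `|ω|` is even. -/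
theorem stmt_1 {n : ℕ} (S : Stabilizer (Fin n)) (ψ : (Fin n → Fin 2) → ℂ)
    (hψ : stabilizesState S ψ) (ω : Finset (Fin n)) (hω : IsMinimalSupport S ω) :
    (Aomega S ω = 1 ∨ Aomega S ω = 3) ∧ (Aomega S ω = 3 → Even ω.card) := by
  have hmem : ∀ M, M ∈ S.elems.filter (fun M => PauliOp.support M = ω) ↔
      M ∈ S.elems ∧ M.support = ω := fun M => Finset.mem_filter
  unfold Aomega
  set T := S.elems.filter fun M => PauliOp.support M = ω
  have hT : 0 < T.card := by
    obtain ⟨M, hM⟩ := hω.1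
    exact Finset.card_pos.mpr ⟨M, (hmem M).mpr hM⟩
  rcases ω.eq_empty_or_nonempty with rfl | hne
  · have hle : T.card ≤ 1 := by
      refine Finset.card_le_one.mpr fun M hM N hN => ?_
      obtain ⟨hM, hMω⟩ := (hmem M).mp hM
      obtain ⟨hN, hNω⟩ := (hmem N).mp hN
      refine PauliOp.eq_of_label_eq hψ.ne_zero (hψ.2 M hM) (hψ.2 N hN) (funext fun i => ?_)
      have h0 : M.label i = 0 := by_contra fun hc =>
        Finset.notMem_empty i (hMω ▸ PauliOp.mem_support.mpr hc)
      have h1 : N.label i = 0 := by_contra fun hc =>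
        Finset.notMem_empty i (hNω ▸ PauliOp.mem_support.mpr hc)
      exact h0.trans h1.symm
    exact ⟨Or.inl (by omega), fun _ => by simp⟩
  · have hle : T.card ≤ 3 := by
      obtain ⟨i, hi⟩ := hne
      refine Finset.card_le_card_of_injOn (t := Finset.univ.erase (0 : Fin 4))
        (fun M => M.label i) (fun M hM => ?_) (fun M hM N hN h => ?_)
      · exact Finset.mem_coe.mpr (Finset.mem_erase.mpr
          ⟨PauliOp.mem_support.mp (((hmem M).mp hM).2 ▸ hi), Finset.mem_univ _⟩)
      · obtain ⟨hM, hMω⟩ := (hmem M).mp hM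
        obtain ⟨hN, hNω⟩ := (hmem N).mp hN
        exact hω.eq_of_label_eq hψ hM hN hMω hNω hi h
    rcases Nat.lt_or_ge 1 T.card with hlt | hge
    · obtain ⟨M, hMT, N, hNT, hMN⟩ := Finset.one_lt_card.mp hlt
      obtain ⟨hM, hMω⟩ := (hmem M).mp hMT
      obtain ⟨hN, hNω⟩ := (hmem N).mp hNT
      obtain ⟨K, hK, hKω, hKM, hKN⟩ := hω.exists_third hψ hne hM hN hMω hNω hMN
      have h3 : 2 < T.card := Finset.two_lt_card.mpr
        ⟨M, hMT, N, hNT, K, (hmem K).mpr ⟨hK, hKω⟩, hMN, hKM.symm, hKN.symm⟩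
      exact ⟨Or.inr (by omega), fun _ => hω.even_card hψ hM hN hMω hNω hMN⟩
    · exact ⟨Or.inl (by omega), fun h => by omega⟩
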